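/- arXiv:2001.03211 — 3 statements merged into one kernel-verified Lean document; each statement's English description precedes it below -/
import Mathlib

section
/- Assume η₁ > 0 satisfies: (i) a₀·y − a₁·(y − a₁·η₁) < 0 for every y ≥ 1−y₀; (ii) η₁ < x₀ − y₀; (iii) f₁(y₀ + a₁·η₁) < x₀. If x, y ∈ [1−x₀, x₀] and |x − y| < η₁, then for every ω ∈ Σ and every natural number n, |f^n_ω(x) − f^n_ω(y)| ≤ a₁·|x − y|. -/
/-
Formalization of the Alsedà–Misiurewicz system setup:
`f0, f1` are the piecewise-linear interval homeomorphisms, `iter` the random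
iteration along ω ∈ Σ = {0,1}^ℕ, `IsKernel` characterises the family x ↦ ℙ_x by
its values on cylinder sets, `Pop` is the Markov operator (as a set function),
`Stationary` expresses P-invariance for probability measures on (0,1), `U` is
the dual operator, and `A1`–`A4` are the assumptions of the paper.
-/

open MeasureTheory Filter Set
open scoped ENNReal Topology

namespace AM

noncomputable def f0 (x₀ y₀ : ℝ) (x : ℝ) : ℝ :=
  if x ≤ x₀ then (y₀ / x₀) * x else ((1 - y₀) / (1 - x₀)) * (x - 1) + 1

noncomputable def f1 (x₀ y₀ : ℝ) (x : ℝ) : ℝ := 1 - f0 x₀ y₀ (1 - x)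

/-- `fb b` is `f₁` if `b = true`, and `f₀` if `b = false`. -/
noncomputable def fb (x₀ y₀ : ℝ) (b : Bool) : ℝ → ℝ :=
  if b then f1 x₀ y₀ else f0 x₀ y₀

/-- `iter x₀ y₀ ω n x = f^n_ω(x) = f_{ω (n-1)} ∘ ⋯ ∘ f_{ω 0} (x)`, with `f^0_ω = id`. -/
noncomputable def iter (x₀ y₀ : ℝ) (ω : ℕ → Bool) : ℕ → ℝ → ℝ
  | 0, x => x
  | n + 1, x => fb x₀ y₀ (ω n) (iter x₀ y₀ ω n x)

/-- `cylProb x₀ y₀ p₀ p₁ x w = p_{i₁}(x) p_{i₂}(f_{i₁} x) ⋯` for the word `w = (i₁, …, i_k)`. -/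
noncomputable def cylProb (x₀ y₀ : ℝ) (p₀ p₁ : ℝ → ℝ) : ℝ → List Bool → ℝ
  | _, [] => 1
  | x, b :: w => (if b then p₁ x else p₀ x) * cylProb x₀ y₀ p₀ p₁ (fb x₀ y₀ b x) w

/-- The cylinder set of sequences starting with the word `w`. -/
def cyl (w : List Bool) : Set (ℕ → Bool) := {ω | ∀ j : Fin w.length, ω j = w.get j}

/-- `IsKernel x₀ y₀ p₀ p₁ Pm` says that `Pm x = ℙ_x` for all `x ∈ (0,1)`, i.e. `Pm x` gives
every cylinder set its prescribed probability (this determines `Pm x` uniquely and makes it a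
probability measure, since the empty word gives `Pm x univ = 1`). -/
def IsKernel (x₀ y₀ : ℝ) (p₀ p₁ : ℝ → ℝ) (Pm : ℝ → Measure (ℕ → Bool)) : Prop :=
  ∀ x ∈ Ioo (0:ℝ) 1, ∀ w : List Bool,
    Pm x (cyl w) = ENNReal.ofReal (cylProb x₀ y₀ p₀ p₁ x w)

/-- The Markov operator `P`, as a set function:
`Pop μ A = ∫_{f₀⁻¹(A)} p₀ dμ + ∫_{f₁⁻¹(A)} p₁ dμ`. -/
noncomputable def Pop (x₀ y₀ : ℝ) (p₀ p₁ : ℝ → ℝ) (μ : Measure ℝ) (A : Set ℝ) : ℝ≥0∞ :=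
  (∫⁻ x in f0 x₀ y₀ ⁻¹' A, ENNReal.ofReal (p₀ x) ∂μ) +
    ∫⁻ x in f1 x₀ y₀ ⁻¹' A, ENNReal.ofReal (p₁ x) ∂μ

/-- A stationary (P-invariant) Borel probability measure on (0,1). -/
def Stationary (x₀ y₀ : ℝ) (p₀ p₁ : ℝ → ℝ) (μ : Measure ℝ) : Prop :=
  IsProbabilityMeasure μ ∧ μ (Ioo 0 1) = 1 ∧
    ∀ A : Set ℝ, MeasurableSet A → A ⊆ Ioo 0 1 → μ A = Pop x₀ y₀ p₀ p₁ μ A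

/-- The dual operator `Uφ(x) = p₀(x) φ(f₀ x) + p₁(x) φ(f₁ x)`. -/
noncomputable def U (x₀ y₀ : ℝ) (p₀ p₁ : ℝ → ℝ) (φ : ℝ → ℝ) : ℝ → ℝ :=
  fun x => p₀ x * φ (f0 x₀ y₀ x) + p₁ x * φ (f1 x₀ y₀ x)

/-- Assumption (A1): `1/2 < x₀ < 1` and `1/2 ≤ y₀ < x₀`. -/
def A1 (x₀ y₀ : ℝ) : Prop := 1/2 < x₀ ∧ x₀ < 1 ∧ 1/2 ≤ y₀ ∧ y₀ < x₀

/-- Assumption (A2): Dini continuity of `p₀, p₁`; `β` is a modulus of continuity for both, with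
`∑ₙ β(C tⁿ) < ∞` for all `C ≥ 0`, `0 < t < 1`. (Such a `β` exists iff the least modulus of
continuity has this summability property.) -/
def A2 (p₀ p₁ : ℝ → ℝ) : Prop :=
  ∃ β : ℝ → ℝ,
    (∀ t : ℝ, ∀ x ∈ Icc (0:ℝ) 1, ∀ y ∈ Icc (0:ℝ) 1, |x - y| ≤ t →
      |p₀ x - p₀ y| ≤ β t ∧ |p₁ x - p₁ y| ≤ β t) ∧
    (∀ C : ℝ, 0 ≤ C → ∀ t : ℝ, 0 < t → t < 1 → Summable fun n : ℕ => β (C * t ^ n))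

/-- Assumption (A3): `p₀, p₁` are continuous, `p₀ + p₁ = 1`, and `0 < pᵢ < 1` on `[0,1]`. -/
def A3 (p₀ p₁ : ℝ → ℝ) : Prop :=
  ContinuousOn p₀ (Icc 0 1) ∧ ContinuousOn p₁ (Icc 0 1) ∧
    ∀ x ∈ Icc (0:ℝ) 1, p₀ x + p₁ x = 1 ∧ 0 < p₀ x ∧ p₀ x < 1 ∧ 0 < p₁ x ∧ p₁ x < 1

/-- Assumption (A4): the average Lyapunov exponents at 0 and 1 are positive
(`a₀ = y₀/x₀`, `a₁ = (1-y₀)/(1-x₀)`). -/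
def A4 (x₀ y₀ : ℝ) (p₀ p₁ : ℝ → ℝ) : Prop :=
  0 < p₀ 0 * Real.log (y₀ / x₀) + p₁ 0 * Real.log ((1 - y₀) / (1 - x₀)) ∧
    0 < p₀ 1 * Real.log ((1 - y₀) / (1 - x₀)) + p₁ 1 * Real.log (y₀ / x₀)

end AM

namespace AM

variable {x₀ y₀ : ℝ}

theorem f0_eq_max (h : A1 x₀ y₀) (z : ℝ) :
    f0 x₀ y₀ z = max (y₀ / x₀ * z) ((1 - y₀) / (1 - x₀) * (z - 1) + 1) := by
  obtain ⟨h1, h2, h3, h4⟩ := h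
  have hx : x₀ ≠ 0 := by linarith
  have hx' : 1 - x₀ ≠ 0 := by linarith
  have h0 : y₀ / x₀ < 1 := (div_lt_one (by linarith)).2 h4
  have h1' : 1 < (1 - y₀) / (1 - x₀) := (one_lt_div (by linarith)).2 (by linarith)
  have e : (1 - y₀) / (1 - x₀) * (z - 1) + 1 - y₀ / x₀ * z =
      ((1 - y₀) / (1 - x₀) - y₀ / x₀) * (z - x₀) := by
    field_simp
    ring
  unfold f0
  split_ifs with hz
  · rw [max_eq_left]
    nlinarith
  · rw [max_eq_right]
    nlinarith

theorem continuous_f0 (h : A1 x₀ y₀) : Continuous (f0 x₀ y₀) := by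
  rw [funext (f0_eq_max h)]
  fun_prop

theorem monotone_f0 (h : A1 x₀ y₀) : Monotone (f0 x₀ y₀) := by
  intro a b hab
  rw [f0_eq_max h, f0_eq_max h]
  obtain ⟨h1, h2, h3, h4⟩ := h
  have h0 : 0 ≤ y₀ / x₀ := div_nonneg (by linarith) (by linarith)
  have h1' : 0 ≤ (1 - y₀) / (1 - x₀) := div_nonneg (by linarith) (by linarith)
  gcongr

theorem continuous_fb (h : A1 x₀ y₀) (b : Bool) : Continuous (fb x₀ y₀ b) := by
  cases b
  · exact continuous_f0 h
  · exact continuous_const.sub ((continuous_f0 h).comp (continuous_const.sub continuous_id))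

theorem monotone_fb (h : A1 x₀ y₀) (b : Bool) : Monotone (fb x₀ y₀ b) := by
  cases b
  · exact monotone_f0 h
  · exact fun s t hst => sub_le_sub_left (monotone_f0 h (sub_le_sub_left hst 1)) 1

theorem continuous_iter (h : A1 x₀ y₀) (ω : ℕ → Bool) (n : ℕ) :
    Continuous (iter x₀ y₀ ω n) := by
  induction n with
  | zero => exact continuous_id
  | succ n ih => exact (continuous_fb h (ω n)).comp ih

theorem monotone_iter (h : A1 x₀ y₀) (ω : ℕ → Bool) (n : ℕ) :
    Monotone (iter x₀ y₀ ω n) := by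
  induction n with
  | zero => exact monotone_id
  | succ n ih => exact (monotone_fb h (ω n)).comp ih

/-- The reciprocal of the density of a metric on `(0,1)` which neither `f₀` nor `f₁` expands. -/
noncomputable def weight (y₀ z : ℝ) : ℝ := min (min z (1 - z)) (1 - y₀)

theorem weight_one_sub (y₀ z : ℝ) : weight y₀ (1 - z) = weight y₀ z := by
  simp [weight, min_comm]

theorem weight_contract {a z : ℝ} (ha : 0 ≤ a) (ha1 : a ≤ 1) (hy : y₀ ≤ 1) :
    a * weight y₀ z ≤ weight y₀ (a * z) := by
  have h1 : weight y₀ z ≤ z := (min_le_left _ _).trans (min_le_left _ _)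
  have h2 : weight y₀ z ≤ 1 - z := (min_le_left _ _).trans (min_le_right _ _)
  have h3 : weight y₀ z ≤ 1 - y₀ := min_le_right _ _
  refine le_min (le_min ?_ ?_) ?_ <;> nlinarith

theorem weight_expand (h : A1 x₀ y₀) {z : ℝ} (hz : x₀ ≤ z) :
    (1 - y₀) / (1 - x₀) * weight y₀ z ≤ weight y₀ ((1 - y₀) / (1 - x₀) * (z - 1) + 1) := by
  obtain ⟨h1, h2, h3, h4⟩ := h
  have ha : 0 ≤ (1 - y₀) / (1 - x₀) := div_nonneg (by linarith) (by linarith)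
  have e : (1 - y₀) / (1 - x₀) * (1 - x₀) = 1 - y₀ := div_mul_cancel₀ _ (by linarith)
  have h5 : weight y₀ z ≤ 1 - z := (min_le_left _ _).trans (min_le_right _ _)
  refine le_min (le_min ?_ ?_) ?_ <;> nlinarith

theorem exists_right_deriv_f0 (h : A1 x₀ y₀) (z : ℝ) :
    ∃ d, 0 ≤ d ∧ HasDerivWithinAt (f0 x₀ y₀) d (Ici z) z ∧
      d * weight y₀ z ≤ weight y₀ (f0 x₀ y₀ z) := by
  have h' := h
  obtain ⟨h1, h2, h3, h4⟩ := h'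
  rcases lt_or_ge z x₀ with hz | hz
  · have ha : 0 ≤ y₀ / x₀ := div_nonneg (by linarith) (by linarith)
    refine ⟨y₀ / x₀, ha, ?_, ?_⟩
    · have hd : HasDerivAt (fun t => y₀ / x₀ * t) (y₀ / x₀) z := by
        simpa using (hasDerivAt_id z).const_mul (y₀ / x₀)
      refine (hd.congr_of_eventuallyEq ?_).hasDerivWithinAt
      filter_upwards [Iio_mem_nhds hz] with t ht
      exact if_pos (le_of_lt ht)
    · rw [f0, if_pos hz.le]
      exact weight_contract ha ((div_le_one (by linarith)).2 h4.le) (by linarith)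
  · have key : ∀ t, x₀ ≤ t → f0 x₀ y₀ t = (1 - y₀) / (1 - x₀) * (t - 1) + 1 := by
      intro t ht
      rcases ht.eq_or_lt with rfl | ht
      · have hx : x₀ ≠ 0 := by linarith
        have hx' : 1 - x₀ ≠ 0 := by linarith
        rw [f0, if_pos le_rfl]
        field_simp
        ring
      · exact if_neg ht.not_ge
    refine ⟨(1 - y₀) / (1 - x₀), div_nonneg (by linarith) (by linarith), ?_, ?_⟩
    · have hd : HasDerivAt (fun t => (1 - y₀) / (1 - x₀) * (t - 1) + 1)
          ((1 - y₀) / (1 - x₀)) z := by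
        simpa using (((hasDerivAt_id z).sub_const 1).const_mul ((1 - y₀) / (1 - x₀))).add_const 1
      exact hd.hasDerivWithinAt.congr (fun t ht => key t (hz.trans ht)) (key z hz)
    · rw [key z hz]
      exact weight_expand h hz

theorem exists_right_deriv_f1 (h : A1 x₀ y₀) (z : ℝ) :
    ∃ d, 0 ≤ d ∧ HasDerivWithinAt (f1 x₀ y₀) d (Ici z) z ∧
      d * weight y₀ z ≤ weight y₀ (f1 x₀ y₀ z) := by
  have h' := h
  obtain ⟨h1, h2, h3, h4⟩ := h'
  rcases lt_or_ge z (1 - x₀) with hz | hz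
  · refine ⟨(1 - y₀) / (1 - x₀), div_nonneg (by linarith) (by linarith), ?_, ?_⟩
    · have hd : HasDerivAt (fun t => (1 - y₀) / (1 - x₀) * t) ((1 - y₀) / (1 - x₀)) z := by
        simpa using (hasDerivAt_id z).const_mul ((1 - y₀) / (1 - x₀))
      refine (hd.congr_of_eventuallyEq ?_).hasDerivWithinAt
      filter_upwards [Iio_mem_nhds hz] with t ht
      rw [f1, f0, if_neg (by rw [mem_Iio] at ht; linarith)]
      ring
    · rw [f1, weight_one_sub, f0, if_neg (by linarith), ← weight_one_sub y₀ z]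
      exact weight_expand h (by linarith)
  · have ha : 0 ≤ y₀ / x₀ := div_nonneg (by linarith) (by linarith)
    refine ⟨y₀ / x₀, ha, ?_, ?_⟩
    · have hd : HasDerivAt (fun t => 1 - y₀ / x₀ * (1 - t)) (y₀ / x₀) z := by
        simpa using (((hasDerivAt_id z).const_sub 1).const_mul (y₀ / x₀)).const_sub 1
      have key : ∀ t, 1 - x₀ ≤ t → f1 x₀ y₀ t = 1 - y₀ / x₀ * (1 - t) := by
        intro t ht
        rw [f1, f0, if_pos (by linarith)]
      exact hd.hasDerivWithinAt.congr (fun t ht => key t (hz.trans ht)) (key z hz)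
    · rw [f1, weight_one_sub, f0, if_pos (by linarith), ← weight_one_sub y₀ z]
      exact weight_contract ha ((div_le_one (by linarith)).2 h4.le) (by linarith)

theorem exists_right_deriv_fb (h : A1 x₀ y₀) (b : Bool) (z : ℝ) :
    ∃ d, 0 ≤ d ∧ HasDerivWithinAt (fb x₀ y₀ b) d (Ici z) z ∧
      d * weight y₀ z ≤ weight y₀ (fb x₀ y₀ b z) := by
  cases b
  · exact exists_right_deriv_f0 h z
  · exact exists_right_deriv_f1 h z

theorem exists_right_deriv_iter (h : A1 x₀ y₀) (ω : ℕ → Bool) (n : ℕ) (z : ℝ) :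
    ∃ d, 0 ≤ d ∧ HasDerivWithinAt (iter x₀ y₀ ω n) d (Ici z) z ∧
      d * weight y₀ z ≤ weight y₀ (iter x₀ y₀ ω n z) := by
  induction n with
  | zero => exact ⟨1, zero_le_one, hasDerivWithinAt_id z _, (one_mul _).le⟩
  | succ n ih =>
    obtain ⟨d, hd0, hd, hdw⟩ := ih
    obtain ⟨e, he0, he, hew⟩ := exists_right_deriv_fb h (ω n) (iter x₀ y₀ ω n z)
    refine ⟨e * d, mul_nonneg he0 hd0,
      he.comp z hd fun t ht => monotone_iter h ω n ht, ?_⟩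
    rw [mul_assoc]
    exact (mul_le_mul_of_nonneg_left hdw he0).trans hew

theorem abs_iter_sub_iter_le_of_le (h : A1 x₀ y₀) (ω : ℕ → Bool) (n : ℕ) {x y : ℝ}
    (hx : 1 - x₀ ≤ x) (hy : y ≤ x₀) (hxy : x ≤ y) :
    |iter x₀ y₀ ω n y - iter x₀ y₀ ω n x| ≤ (1 - y₀) / (1 - x₀) * |y - x| := by
  choose d hd0 hd hdw using exists_right_deriv_iter h ω n
  obtain ⟨h1, h2, h3, h4⟩ := id h
  rw [abs_of_nonneg (sub_nonneg.2 hxy)]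
  refine norm_image_sub_le_of_norm_deriv_right_le_segment
    (continuous_iter h ω n).continuousOn (fun z _ => hd z) (fun z hz => ?_) y
    (right_mem_Icc.2 hxy)
  have hw : 1 - x₀ ≤ weight y₀ z :=
    le_min (le_min (hx.trans hz.1) (by linarith [hz.2])) (by linarith)
  rw [Real.norm_of_nonneg (hd0 z), le_div_iff₀ (by linarith)]
  exact (mul_le_mul_of_nonneg_left hw (hd0 z)).trans ((hdw z).trans (min_le_right _ _))

end AM

/-- Proposition 1: with `η₁` as in Statement 4, if `x, y ∈ [1−x₀, x₀]` and
`|x − y| < η₁`, then `|f^n_ω(x) − f^n_ω(y)| ≤ a₁ |x − y|` for every `ω` and every `n`. -/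
theorem stmt8 (x₀ y₀ : ℝ) (hA1 : AM.A1 x₀ y₀)
    (η₁ : ℝ) (hη : 0 < η₁)
    (hi : ∀ y : ℝ, 1 - y₀ ≤ y →
      (y₀ / x₀) * y - ((1 - y₀) / (1 - x₀)) * (y - ((1 - y₀) / (1 - x₀)) * η₁) < 0)
    (hii : η₁ < x₀ - y₀)
    (hiii : AM.f1 x₀ y₀ (y₀ + ((1 - y₀) / (1 - x₀)) * η₁) < x₀)
    (x y : ℝ) (hx : x ∈ Set.Icc (1 - x₀) x₀) (hy : y ∈ Set.Icc (1 - x₀) x₀)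
    (hclose : |x - y| < η₁) :
    ∀ (ω : ℕ → Bool) (n : ℕ),
      |AM.iter x₀ y₀ ω n x - AM.iter x₀ y₀ ω n y| ≤
        ((1 - y₀) / (1 - x₀)) * |x - y| := by
  intro ω n
  rcases le_total x y with hxy | hxy
  · rw [abs_sub_comm, abs_sub_comm x]
    exact AM.abs_iter_sub_iter_le_of_le hA1 ω n hx.1 hy.2 hxy
  · exact AM.abs_iter_sub_iter_le_of_le hA1 ω n hy.1 hx.2 hxy
end

section
/- Under assumption (A1), let η > 0 satisfy f₁(y₀ + a₁·η) < x₀. Then the composition f₀∘f₁ maps the interval [1−x₀, y₀ + a₁·η] into itself and is a contraction on this interval (Lipschitz with a constant strictly smaller than 1); consequently f₀∘f₁ has a unique fixed point c in [1−x₀, y₀ + a₁·η], and this fixed point satisfies c ∈ (1−x₀, y₀). -/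
/-
Formalization of the Alsedà–Misiurewicz system setup:
`f0, f1` are the piecewise-linear interval homeomorphisms, `iter` the random
iteration along ω ∈ Σ = {0,1}^ℕ, `IsKernel` characterises the family x ↦ ℙ_x by
its values on cylinder sets, `Pop` is the Markov operator (as a set function),
`Stationary` expresses P-invariance for probability measures on (0,1), `U` is
the dual operator, and `A1`–`A4` are the assumptions of the paper.
-/

open MeasureTheory Filter Set
open scoped ENNReal Topology

namespace AM

/-- On `[1 - x₀, B]` with `f₁ B < x₀`, the composition `f₀ ∘ f₁` uses only the branches of slope
`y₀ / x₀`, so it is affine there. -/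
theorem f0_f1_eq_of_le {x₀ y₀ z B : ℝ} (hx : 0 < x₀) (hy : 0 ≤ y₀) (hz : 1 - x₀ ≤ z)
    (hzB : z ≤ B) (hB : f1 x₀ y₀ B < x₀) :
    f0 x₀ y₀ (f1 x₀ y₀ z) = y₀ / x₀ * (1 - y₀ / x₀ * (1 - z)) := by
  have hf1 : ∀ w, 1 - x₀ ≤ w → f1 x₀ y₀ w = 1 - y₀ / x₀ * (1 - w) := fun w hw => by
    rw [f1, f0, if_pos (by linarith)]
  rw [hf1 B (hz.trans hzB)] at hB
  have hmono : y₀ / x₀ * (1 - B) ≤ y₀ / x₀ * (1 - z) :=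
    mul_le_mul_of_nonneg_left (by linarith) (div_nonneg hy hx.le)
  rw [hf1 z hz, f0, if_pos (by linarith)]

end AM

/-- under (A1), if `η > 0` satisfies `f₁(y₀ + a₁ η) < x₀`, then `f₀ ∘ f₁` maps
`[1−x₀, y₀ + a₁ η]` into itself and is a contraction on it; consequently it has a unique fixed
point `c` there, and `c ∈ (1−x₀, y₀)`. -/
theorem stmt11 (x₀ y₀ : ℝ) (hA1 : AM.A1 x₀ y₀)
    (η : ℝ) (hη : 0 < η)
    (hiii : AM.f1 x₀ y₀ (y₀ + ((1 - y₀) / (1 - x₀)) * η) < x₀) :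
    Set.MapsTo (fun z => AM.f0 x₀ y₀ (AM.f1 x₀ y₀ z))
      (Set.Icc (1 - x₀) (y₀ + ((1 - y₀) / (1 - x₀)) * η))
      (Set.Icc (1 - x₀) (y₀ + ((1 - y₀) / (1 - x₀)) * η)) ∧
    (∃ K : ℝ, 0 ≤ K ∧ K < 1 ∧
      ∀ u ∈ Set.Icc (1 - x₀) (y₀ + ((1 - y₀) / (1 - x₀)) * η),
        ∀ v ∈ Set.Icc (1 - x₀) (y₀ + ((1 - y₀) / (1 - x₀)) * η),
          |AM.f0 x₀ y₀ (AM.f1 x₀ y₀ u) - AM.f0 x₀ y₀ (AM.f1 x₀ y₀ v)| ≤ K * |u - v|) ∧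
    (∃! c : ℝ, c ∈ Set.Icc (1 - x₀) (y₀ + ((1 - y₀) / (1 - x₀)) * η) ∧
      AM.f0 x₀ y₀ (AM.f1 x₀ y₀ c) = c) ∧
    (∀ c ∈ Set.Icc (1 - x₀) (y₀ + ((1 - y₀) / (1 - x₀)) * η),
      AM.f0 x₀ y₀ (AM.f1 x₀ y₀ c) = c → c ∈ Set.Ioo (1 - x₀) y₀) := by
  obtain ⟨hx, hx1, hy, hyx⟩ := hA1
  have hx0 : 0 < x₀ := by linarith
  have hy0 : 0 < y₀ := by linarith
  have hb : 0 < (1 - y₀) / (1 - x₀) * η :=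
    mul_pos (div_pos (by linarith) (by linarith)) hη
  generalize hB : y₀ + (1 - y₀) / (1 - x₀) * η = B at hiii ⊢
  have hyB : y₀ < B := by linarith
  set q : ℝ := (y₀ / x₀) ^ 2 with hq
  set p : ℝ := y₀ / (x₀ + y₀) with hp
  have hq0 : 0 ≤ q := sq_nonneg _
  have hq1 : q < 1 :=
    pow_lt_one₀ (div_pos hy0 hx0).le ((div_lt_one hx0).2 hyx) two_ne_zero
  have hpx : 1 - x₀ < p := by
    rw [hp, lt_div_iff₀ (by linarith)]
    nlinarith
  have hpy : p < y₀ := by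
    rw [hp, div_lt_iff₀ (by linarith)]
    nlinarith
  have hg : ∀ z ∈ Set.Icc (1 - x₀) B,
      AM.f0 x₀ y₀ (AM.f1 x₀ y₀ z) = p + q * (z - p) := by
    rintro z ⟨hz, hzB⟩
    rw [AM.f0_f1_eq_of_le hx0 hy0.le hz hzB hiii, hp, hq]
    field_simp
    ring
  have hfix : ∀ c ∈ Set.Icc (1 - x₀) B, AM.f0 x₀ y₀ (AM.f1 x₀ y₀ c) = c → c = p := by
    intro c hc h
    rw [hg c hc] at h
    have h0 : (1 - q) * (c - p) = 0 := by linarith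
    rcases mul_eq_zero.1 h0 with h1 | h1 <;> linarith
  have hpI : p ∈ Set.Icc (1 - x₀) B := ⟨hpx.le, by linarith⟩
  refine ⟨?_, ⟨q, hq0, hq1, ?_⟩, ⟨p, ⟨hpI, ?_⟩, ?_⟩, ?_⟩
  · intro z hz
    change AM.f0 x₀ y₀ (AM.f1 x₀ y₀ z) ∈ _
    rw [hg z hz]
    have hz1 := hz.1
    have hz2 := hz.2
    constructor <;> nlinarith
  · intro u hu v hv
    rw [hg u hu, hg v hv, show p + q * (u - p) - (p + q * (v - p)) = q * (u - v) by ring,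
      abs_mul, abs_of_nonneg hq0]
  · rw [hg p hpI]
    ring
  · rintro c ⟨hc, h⟩
    exact hfix c hc h
  · intro c hc h
    rw [hfix c hc h]
    exact ⟨hpx, hpy⟩
end

section
/- Under assumptions (A1)–(A4) there exists h ∈ (0, 1/2) such that for every ξ ∈ (0, 1/2) there exists a natural number n₀ such that ℙ_x({ω ∈ Σ : f^n_ω(x) ∈ [h, 1−h]}) ≥ 1/2 for every x ∈ [ξ, 1−ξ] and every n ≥ n₀. -/
/-
Formalization of the Alsedà–Misiurewicz system setup:
`f0, f1` are the piecewise-linear interval homeomorphisms, `iter` the random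
iteration along ω ∈ Σ = {0,1}^ℕ, `IsKernel` characterises the family x ↦ ℙ_x by
its values on cylinder sets, `Pop` is the Markov operator (as a set function),
`Stationary` expresses P-invariance for probability measures on (0,1), `U` is
the dual operator, and `A1`–`A4` are the assumptions of the paper.
-/

open MeasureTheory Filter Set
open scoped ENNReal Topology

namespace AM

variable {x₀ y₀ : ℝ}

lemma A1.slopes (h : A1 x₀ y₀) :
    0 < y₀ / x₀ ∧ y₀ / x₀ < 1 ∧ 1 < (1 - y₀) / (1 - x₀) := by
  obtain ⟨h1, h2, h3, h4⟩ := h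
  refine ⟨by apply div_pos <;> linarith, ?_, ?_⟩
  · rw [div_lt_one (by linarith)]; exact h4
  · rw [one_lt_div (by linarith)]; linarith

lemma f0_le_self (h : A1 x₀ y₀) {x : ℝ} (hx : x ∈ Ioo (0 : ℝ) 1) : f0 x₀ y₀ x ≤ x := by
  obtain ⟨ha, hb, hc⟩ := h.slopes
  obtain ⟨hx0, hx1⟩ := hx
  unfold f0
  split_ifs <;> nlinarith

lemma mul_le_f0 (h : A1 x₀ y₀) {x : ℝ} : y₀ / x₀ * x ≤ f0 x₀ y₀ x := by
  obtain ⟨ha, hb, hc⟩ := h.slopes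
  obtain ⟨h1, h2, h3, h4⟩ := h
  unfold f0
  split_ifs with hx
  · exact le_rfl
  · have e1 : y₀ / x₀ * x₀ = y₀ := div_mul_cancel₀ _ (by linarith)
    have e2 : (1 - y₀) / (1 - x₀) * (1 - x₀) = 1 - y₀ := div_mul_cancel₀ _ (by linarith)
    nlinarith

lemma f0_mem (h : A1 x₀ y₀) {x : ℝ} (hx : x ∈ Ioo (0 : ℝ) 1) : f0 x₀ y₀ x ∈ Ioo (0 : ℝ) 1 :=
  ⟨(mul_pos h.slopes.1 hx.1).trans_le (mul_le_f0 h), (f0_le_self h hx).trans_lt hx.2⟩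

lemma one_sub_mem {x : ℝ} (hx : x ∈ Ioo (0 : ℝ) 1) : 1 - x ∈ Ioo (0 : ℝ) 1 :=
  ⟨by linarith [hx.2], by linarith [hx.1]⟩

lemma f1_mem (h : A1 x₀ y₀) {x : ℝ} (hx : x ∈ Ioo (0 : ℝ) 1) : f1 x₀ y₀ x ∈ Ioo (0 : ℝ) 1 :=
  one_sub_mem (f0_mem h (one_sub_mem hx))

lemma mul_le_f1 (h : A1 x₀ y₀) {x : ℝ} (hx : x ∈ Ioo (0 : ℝ) 1) :
    y₀ / x₀ * x ≤ f1 x₀ y₀ x := by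
  have h1 := f0_le_self h (one_sub_mem hx)
  have h2 := h.slopes.2.1
  unfold f1
  nlinarith [hx.1]

lemma fb_mem (h : A1 x₀ y₀) (b : Bool) {x : ℝ} (hx : x ∈ Ioo (0 : ℝ) 1) :
    fb x₀ y₀ b x ∈ Ioo (0 : ℝ) 1 := by
  cases b
  · exact f0_mem h hx
  · exact f1_mem h hx

/-- A positive average Lyapunov exponent makes `p a^(-α) + q b^(-α)` contract for small `α > 0`. -/
lemma eventually_mul_rpow_neg_lt_one {a b p q : ℝ} (ha : 0 < a) (hb : 0 < b) (hpq : p + q = 1)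
    (hL : 0 < p * Real.log a + q * Real.log b) :
    ∀ᶠ α in 𝓝[>] (0 : ℝ), p * a ^ (-α) + q * b ^ (-α) < 1 := by
  have hd : HasDerivAt (fun α : ℝ => p * a ^ (-α) + q * b ^ (-α))
      (-(p * Real.log a + q * Real.log b)) 0 := by
    have h1 := ((hasDerivAt_id (0 : ℝ)).neg.const_rpow ha).const_mul p
    have h2 := ((hasDerivAt_id (0 : ℝ)).neg.const_rpow hb).const_mul q
    refine (h1.add h2).congr_deriv ?_
    simp
    ring
  have hs := (hasDerivAt_iff_tendsto_slope.1 hd).eventually_lt_const (neg_lt_zero.2 hL)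
  filter_upwards [hs.filter_mono (nhdsWithin_mono _ fun x (hx : 0 < x) => ne_of_gt hx),
    self_mem_nhdsWithin] with α h1 (h2 : 0 < α)
  simp only [slope_def_field, sub_zero, neg_zero, Real.rpow_zero, mul_one, hpq] at h1
  have := (div_neg_iff.1 h1).resolve_left (fun h => absurd h.2 h2.not_gt)
  linarith [this.1]

/-- Drift condition at the endpoint `0` for the Lyapunov function `x ↦ x^(-α)`. -/
lemma eventually_drift (h : A1 x₀ y₀) {q₀ q₁ : ℝ → ℝ} (hq : A3 q₀ q₁)
    (hL : 0 < q₀ 0 * Real.log (y₀ / x₀) + q₁ 0 * Real.log ((1 - y₀) / (1 - x₀))) :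
    ∀ᶠ α in 𝓝[>] (0 : ℝ), ∃ ρ K : ℝ, 0 < ρ ∧ ρ < 1 ∧ 0 ≤ K ∧ ∀ x ∈ Ioo (0 : ℝ) 1,
      U x₀ y₀ q₀ q₁ (fun t => t ^ (-α)) x ≤ ρ * x ^ (-α) + K := by
  obtain ⟨hq0, hq1, hq⟩ := hq
  obtain ⟨ha, ha1, hb⟩ := h.slopes
  set a := y₀ / x₀ with ha_def
  set b := (1 - y₀) / (1 - x₀) with hb_def
  have hb0 : 0 < b := by linarith
  have h00 := hq 0 (by simp)
  filter_upwards [eventually_mul_rpow_neg_lt_one ha hb0 h00.1 hL, self_mem_nhdsWithin]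
    with α hα (hα0 : 0 < α)
  have hcont : ContinuousOn (fun x => q₀ x * a ^ (-α) + q₁ x * b ^ (-α)) (Icc 0 1) :=
    (hq0.mul continuousOn_const).add (hq1.mul continuousOn_const)
  have hg0 : 0 < q₀ 0 * a ^ (-α) + q₁ 0 * b ^ (-α) :=
    add_pos (mul_pos h00.2.1 (Real.rpow_pos_of_pos ha _))
      (mul_pos h00.2.2.2.1 (Real.rpow_pos_of_pos hb0 _))
  obtain ⟨ρ, hρ, hρ1⟩ := exists_between hα
  obtain ⟨ε, hε, hball⟩ := Metric.mem_nhdsWithin_iff.1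
    ((hcont 0 (by simp)).eventually_lt_const hρ)
  set δ := min ε (1 - x₀) with hδ_def
  have hδ : 0 < δ := lt_min hε (by linarith [h.2.1])
  have hK : 0 < (a * δ) ^ (-α) := Real.rpow_pos_of_pos (mul_pos ha hδ) _
  refine ⟨ρ, (a * δ) ^ (-α), hg0.trans hρ, hρ1, hK.le, fun x hx => ?_⟩
  have hxα : 0 < x ^ (-α) := Real.rpow_pos_of_pos hx.1 _
  obtain ⟨hs, hp0, -, hp1, -⟩ := hq x ⟨hx.1.le, hx.2.le⟩
  simp only [U]
  rcases lt_or_ge x δ with hxδ | hxδ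
  · have e0 : f0 x₀ y₀ x = a * x := by
      unfold f0
      rw [if_pos]
      linarith [hxδ.trans_le (min_le_right ε (1 - x₀)), h.1]
    have e1 : f1 x₀ y₀ x = b * x := by
      unfold f1 f0
      rw [if_neg (by linarith [hxδ.trans_le (min_le_right ε (1 - x₀))]), ← hb_def]
      ring
    have hlt : q₀ x * a ^ (-α) + q₁ x * b ^ (-α) < ρ := hball
      ⟨by simpa [abs_of_pos hx.1] using hxδ.trans_le (min_le_left _ _), hx.1.le, hx.2.le⟩
    rw [e0, e1, Real.mul_rpow ha.le hx.1.le, Real.mul_rpow hb0.le hx.1.le]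
    nlinarith [mul_lt_mul_of_pos_right hlt hxα]
  · have hmono : ∀ y, a * x ≤ y → y ^ (-α) ≤ (a * δ) ^ (-α) := fun y hy =>
      Real.rpow_le_rpow_of_nonpos (mul_pos ha hδ)
        ((mul_le_mul_of_nonneg_left hxδ ha.le).trans hy) (by linarith)
    have h1 := mul_le_mul_of_nonneg_left (hmono _ (mul_le_f0 h)) hp0.le
    have h2 := mul_le_mul_of_nonneg_left (hmono _ (mul_le_f1 h hx)) hp1.le
    have h3 := mul_pos (hg0.trans hρ) hxα
    calc _ ≤ q₀ x * (a * δ) ^ (-α) + q₁ x * (a * δ) ^ (-α) := add_le_add h1 h2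
      _ = (a * δ) ^ (-α) := by rw [← add_mul, hs, one_mul]
      _ ≤ _ := by linarith

/-- The two-sided Lyapunov function. -/
noncomputable def lyap (α x : ℝ) : ℝ := x ^ (-α) + (1 - x) ^ (-α)

lemma A3.reflect {p₀ p₁ : ℝ → ℝ} (h : A3 p₀ p₁) :
    A3 (fun x => p₁ (1 - x)) (fun x => p₀ (1 - x)) := by
  have hm : MapsTo (fun x : ℝ => 1 - x) (Icc 0 1) (Icc 0 1) := fun x hx =>
    ⟨by linarith [hx.2], by linarith [hx.1]⟩
  have hc : ContinuousOn (fun x : ℝ => 1 - x) (Icc 0 1) := by fun_prop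
  refine ⟨h.2.1.comp hc hm, h.1.comp hc hm, fun x hx => ?_⟩
  obtain ⟨h1, h2, h3, h4, h5⟩ := h.2.2 _ (hm hx)
  exact ⟨by simpa [add_comm] using h1, h4, h5, h2, h3⟩

lemma exists_drift {p₀ p₁ : ℝ → ℝ} (h : A1 x₀ y₀) (h3 : A3 p₀ p₁) (h4 : A4 x₀ y₀ p₀ p₁) :
    ∃ α ρ K : ℝ, 0 < α ∧ 0 < ρ ∧ ρ < 1 ∧ 0 ≤ K ∧ ∀ x ∈ Ioo (0 : ℝ) 1,
      U x₀ y₀ p₀ p₁ (lyap α) x ≤ ρ * lyap α x + K := by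
  have hR := eventually_drift h h3.reflect (by simpa [add_comm] using h4.2)
  obtain ⟨α, ⟨⟨ρ, K, hρ, hρ1, hK, hd⟩, ⟨ρ', K', hρ', hρ1', hK', hd'⟩⟩, hα⟩ :=
    (((eventually_drift h h3 h4.1).and hR).and self_mem_nhdsWithin).exists
  refine ⟨α, max ρ ρ', K + K', hα, lt_max_of_lt_left hρ, max_lt hρ1 hρ1', add_nonneg hK hK',
    fun x hx => ?_⟩
  have e1 := hd x hx
  have e2 := hd' (1 - x) (one_sub_mem hx)
  have i1 := mul_le_mul_of_nonneg_right (le_max_left ρ ρ') (Real.rpow_pos_of_pos hx.1 (-α)).le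
  have i2 := mul_le_mul_of_nonneg_right (le_max_right ρ ρ')
    (Real.rpow_pos_of_pos (one_sub_mem hx).1 (-α)).le
  simp only [U, lyap, f1, sub_sub_cancel] at e1 e2 ⊢
  linarith

variable (x₀ y₀) in
/-- The image of `x` under the composition prescribed by the word `w`. -/
noncomputable def wordMap : List Bool → ℝ → ℝ
  | [], x => x
  | b :: w, x => wordMap w (fb x₀ y₀ b x)

lemma wordMap_append (w : List Bool) (b : Bool) (x : ℝ) :
    wordMap x₀ y₀ (w ++ [b]) x = fb x₀ y₀ b (wordMap x₀ y₀ w x) := by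
  induction w generalizing x with
  | nil => rfl
  | cons c w ih => exact ih _

lemma wordMap_mem (h : A1 x₀ y₀) (w : List Bool) {x : ℝ} (hx : x ∈ Ioo (0 : ℝ) 1) :
    wordMap x₀ y₀ w x ∈ Ioo (0 : ℝ) 1 := by
  induction w generalizing x with
  | nil => exact hx
  | cons c w ih => exact ih (fb_mem h c hx)

lemma cylProb_append (p₀ p₁ : ℝ → ℝ) (w : List Bool) (b : Bool) (x : ℝ) :
    cylProb x₀ y₀ p₀ p₁ x (w ++ [b]) = cylProb x₀ y₀ p₀ p₁ x w *
      (if b then p₁ (wordMap x₀ y₀ w x) else p₀ (wordMap x₀ y₀ w x)) := by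
  induction w generalizing x with
  | nil => simp [cylProb, wordMap]
  | cons c w ih => simp only [List.cons_append, cylProb, ih, wordMap, mul_assoc]

lemma cylProb_nonneg {p₀ p₁ : ℝ → ℝ} (h : A1 x₀ y₀) (h3 : A3 p₀ p₁) (w : List Bool) {x : ℝ}
    (hx : x ∈ Ioo (0 : ℝ) 1) : 0 ≤ cylProb x₀ y₀ p₀ p₁ x w := by
  induction w generalizing x with
  | nil => exact zero_le_one
  | cons c w ih =>
    obtain ⟨-, hp0, -, hp1, -⟩ := h3.2.2 x ⟨hx.1.le, hx.2.le⟩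
    refine mul_nonneg ?_ (ih (fb_mem h c hx))
    split_ifs
    exacts [hp1.le, hp0.le]

lemma mem_cyl_append {w : List Bool} {b : Bool} {ω : ℕ → Bool} :
    ω ∈ cyl (w ++ [b]) ↔ ω ∈ cyl w ∧ ω w.length = b := by
  simp only [cyl, mem_ofPred_eq, Fin.forall_iff, List.get_eq_getElem, List.length_append,
    List.length_singleton]
  constructor
  · intro H
    refine ⟨fun i hi => ?_, ?_⟩
    · rw [H i (by omega), List.getElem_append_left hi]
    · rw [H w.length (by omega)]
      simp
  · rintro ⟨H, hb⟩ i hi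
    rcases Nat.lt_succ_iff_lt_or_eq.1 hi with hi' | rfl
    · rw [H i hi', List.getElem_append_left hi']
    · simpa using hb

lemma iter_eq_wordMap {w : List Bool} {ω : ℕ → Bool} (hω : ω ∈ cyl w) (x : ℝ) :
    iter x₀ y₀ ω w.length x = wordMap x₀ y₀ w x := by
  induction w using List.reverseRecOn with
  | nil => rfl
  | append_singleton w b ih =>
    obtain ⟨h1, h2⟩ := mem_cyl_append.1 hω
    rw [wordMap_append, List.length_append, List.length_singleton, iter, ih h1, h2]

/-- If `V` satisfies a drift inequality with rate `ρ` and equilibrium level `M`, then the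
probability of leaving `A` is controlled by `V` as in Markov's inequality. -/
lemma measure_cyl_inter_le {p₀ p₁ : ℝ → ℝ} (h : A1 x₀ y₀) (h3 : A3 p₀ p₁)
    {Pm : ℝ → Measure (ℕ → Bool)} (hPm : IsKernel x₀ y₀ p₀ p₁ Pm) {V : ℝ → ℝ} {ρ M c : ℝ}
    (hρ : 0 < ρ) (hc : 0 < c) {A : Set ℝ} (hV0 : ∀ y ∈ Ioo (0 : ℝ) 1, 0 ≤ V y)
    (hV : ∀ y ∈ Ioo (0 : ℝ) 1, y ∉ A → c ≤ V y)
    (hd : ∀ y ∈ Ioo (0 : ℝ) 1, U x₀ y₀ p₀ p₁ V y ≤ ρ * V y + (1 - ρ) * M)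
    (hM : 0 ≤ M) (hρ1 : ρ < 1) {x : ℝ} (hx : x ∈ Ioo (0 : ℝ) 1) (n : ℕ) (w : List Bool) :
    Pm x (cyl w ∩ {ω | iter x₀ y₀ ω (w.length + n) x ∉ A}) ≤
      ENNReal.ofReal (cylProb x₀ y₀ p₀ p₁ x w *
        ((ρ ^ n * (V (wordMap x₀ y₀ w x) - M) + M) / c)) := by
  induction n generalizing w with
  | zero =>
    have hy := wordMap_mem h w hx
    by_cases hA : wordMap x₀ y₀ w x ∈ A
    · have : cyl w ∩ {ω | iter x₀ y₀ ω (w.length + 0) x ∉ A} = ∅ := by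
        ext ω
        simp only [mem_inter_iff, mem_ofPred_eq, mem_empty_iff_false, iff_false, not_and, not_not]
        intro hω
        rwa [add_zero, iter_eq_wordMap hω]
      rw [this, measure_empty]
      exact zero_le
    · refine (measure_mono inter_subset_left).trans ?_
      rw [hPm x hx]
      refine ENNReal.ofReal_le_ofReal (le_mul_of_one_le_right (cylProb_nonneg h h3 w hx) ?_)
      rw [one_le_div hc]
      simpa using hV _ hy hA
  | succ n ih =>
    set y := wordMap x₀ y₀ w x with hy_def
    have hy : y ∈ Ioo (0 : ℝ) 1 := wordMap_mem h w hx
    have hB : ∀ z ∈ Ioo (0 : ℝ) 1, 0 ≤ (ρ ^ n * (V z - M) + M) / c := fun z hz => by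
      have h1 : ρ ^ n ≤ 1 := pow_le_one₀ hρ.le hρ1.le
      have h2 := mul_nonneg (pow_pos hρ n).le (hV0 z hz)
      exact div_nonneg (by nlinarith) hc.le
    have hsub : cyl w ∩ {ω | iter x₀ y₀ ω (w.length + (n + 1)) x ∉ A} ⊆
        (cyl (w ++ [false]) ∩ {ω | iter x₀ y₀ ω ((w ++ [false]).length + n) x ∉ A}) ∪
        (cyl (w ++ [true]) ∩ {ω | iter x₀ y₀ ω ((w ++ [true]).length + n) x ∉ A}) := by
      rintro ω ⟨h1, h2⟩
      have e : ∀ b : Bool, (w ++ [b]).length + n = w.length + (n + 1) := fun b => by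
        simp; omega
      cases hb : ω w.length
      · exact Or.inl ⟨mem_cyl_append.2 ⟨h1, hb⟩, by rw [e]; exact h2⟩
      · exact Or.inr ⟨mem_cyl_append.2 ⟨h1, hb⟩, by rw [e]; exact h2⟩
    refine (measure_mono hsub).trans ((measure_union_le _ _).trans
      ((add_le_add (ih _) (ih _)).trans ?_))
    rw [← ENNReal.ofReal_add
      (mul_nonneg (cylProb_nonneg h h3 _ hx) (hB _ (wordMap_mem h _ hx)))
      (mul_nonneg (cylProb_nonneg h h3 _ hx) (hB _ (wordMap_mem h _ hx)))]
    refine ENNReal.ofReal_le_ofReal ?_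
    simp only [cylProb_append, wordMap_append, ← hy_def, fb, if_true, Bool.false_eq_true, if_false]
    rw [mul_assoc, mul_assoc, ← mul_add]
    refine mul_le_mul_of_nonneg_left ?_ (cylProb_nonneg h h3 w hx)
    rw [mul_div_assoc', mul_div_assoc', ← add_div]
    refine div_le_div_of_nonneg_right ?_ hc.le
    have hs := (h3.2.2 y ⟨hy.1.le, hy.2.le⟩).1
    have hdy := mul_le_mul_of_nonneg_left (hd y hy) (pow_pos hρ n).le
    have hp1 : p₁ y = 1 - p₀ y := by linarith
    simp only [U, hp1] at hdy ⊢
    rw [pow_succ]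
    linarith

end AM

/-- Lemma 5: there exists `h ∈ (0, 1/2)` such that for every `ξ ∈ (0, 1/2)`
there is `n₀` with `ℙ_x(f^n_ω(x) ∈ [h, 1−h]) ≥ 1/2` for all `x ∈ [ξ, 1−ξ]` and `n ≥ n₀`. -/
theorem stmt13 (x₀ y₀ : ℝ) (p₀ p₁ : ℝ → ℝ)
    (hA1 : AM.A1 x₀ y₀) (hA2 : AM.A2 p₀ p₁) (hA3 : AM.A3 p₀ p₁) (hA4 : AM.A4 x₀ y₀ p₀ p₁)
    (Pm : ℝ → MeasureTheory.Measure (ℕ → Bool)) (hPm : AM.IsKernel x₀ y₀ p₀ p₁ Pm) :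
    ∃ h : ℝ, 0 < h ∧ h < 1/2 ∧
      ∀ ξ : ℝ, 0 < ξ → ξ < 1/2 →
        ∃ n₀ : ℕ, ∀ x ∈ Set.Icc ξ (1 - ξ), ∀ n ≥ n₀,
          ENNReal.ofReal (1/2) ≤
            Pm x {ω : ℕ → Bool | AM.iter x₀ y₀ ω n x ∈ Set.Icc h (1 - h)} := by
  obtain ⟨α, ρ, K, hα, hρ, hρ1, hK, hd⟩ := AM.exists_drift hA1 hA3 hA4
  have hρ' : 0 < 1 - ρ := by linarith
  set M := K / (1 - ρ) with hM_def
  have hM : 0 ≤ M := div_nonneg hK hρ'.le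
  have hMK : (1 - ρ) * M = K := mul_div_cancel₀ _ hρ'.ne'
  have hlim : Tendsto (fun t : ℝ => t ^ (-α)) (𝓝[>] 0) atTop :=
    tendsto_rpow_neg_nhdsGT_zero (by linarith)
  obtain ⟨ε, hε, hεc⟩ := mem_nhdsGT_iff_exists_Ioo_subset.1
    (hlim.eventually_ge_atTop (2 * (M + 1)))
  have hε : 0 < ε := hε
  have hpos : ∀ y ∈ Ioo (0 : ℝ) 1, 0 < y ^ (-α) ∧ 0 < (1 - y) ^ (-α) := fun y hy =>
    ⟨Real.rpow_pos_of_pos hy.1 _, Real.rpow_pos_of_pos (AM.one_sub_mem hy).1 _⟩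
  refine ⟨min ε (1 / 4), lt_min hε (by norm_num),
    (min_le_right _ _).trans_lt (by norm_num), fun ξ hξ hξ2 => ?_⟩
  have hzero : Tendsto (fun n : ℕ => ρ ^ n * (2 * ξ ^ (-α))) atTop (𝓝 0) := by
    simpa using (tendsto_pow_atTop_nhds_zero_of_lt_one hρ.le hρ1).mul_const (2 * ξ ^ (-α))
  obtain ⟨n₀, hn₀⟩ := eventually_atTop.1 (hzero.eventually_le_const one_pos)
  refine ⟨n₀, fun x hx n hn => ?_⟩
  have hx01 : x ∈ Ioo (0 : ℝ) 1 := ⟨by linarith [hx.1], by linarith [hx.2]⟩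
  set A := Icc (min ε (1 / 4)) (1 - min ε (1 / 4)) with hA_def
  have hV : ∀ y ∈ Ioo (0 : ℝ) 1, y ∉ A → 2 * (M + 1) ≤ AM.lyap α y := fun y hy hyA => by
    obtain ⟨h1, h2⟩ := hpos y hy
    unfold AM.lyap
    rcases lt_or_ge y (min ε (1 / 4)) with h | h
    · have : 2 * (M + 1) ≤ y ^ (-α) := hεc ⟨hy.1, h.trans_le (min_le_left _ _)⟩
      linarith
    · have h' : 1 - y < min ε (1 / 4) := by
        by_contra! h'
        exact hyA ⟨h, by linarith⟩
      have : 2 * (M + 1) ≤ (1 - y) ^ (-α) :=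
        hεc ⟨by linarith [hy.2], h'.trans_le (min_le_left _ _)⟩
      linarith
  have hbad := AM.measure_cyl_inter_le hA1 hA3 hPm (V := AM.lyap α) hρ (c := 2 * (M + 1)) (by linarith)
    (fun y hy => (add_pos (hpos y hy).1 (hpos y hy).2).le) hV
    (fun y hy => by rw [hMK]; exact hd y hy) hM hρ1 hx01 n []
  have hVx : AM.lyap α x ≤ 2 * ξ ^ (-α) := by
    have h1 : x ^ (-α) ≤ ξ ^ (-α) := Real.rpow_le_rpow_of_nonpos hξ hx.1 (by linarith)
    have h2 : (1 - x) ^ (-α) ≤ ξ ^ (-α) :=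
      Real.rpow_le_rpow_of_nonpos hξ (by linarith [hx.2]) (by linarith)
    unfold AM.lyap
    linarith
  have hhalf : (ρ ^ n * (AM.lyap α x - M) + M) / (2 * (M + 1)) ≤ 1 / 2 := by
    rw [div_le_iff₀ (by linarith)]
    have h1 := hn₀ n hn
    have h2 := mul_le_mul_of_nonneg_left hVx (pow_pos hρ n).le
    have h3 := mul_nonneg (pow_pos hρ n).le hM
    linarith
  have huniv : Pm x univ = 1 := by
    simpa [AM.cyl, AM.cylProb] using hPm x hx01 []
  have hbad' : Pm x {ω | AM.iter x₀ y₀ ω n x ∉ A} ≤ ENNReal.ofReal (1 / 2) := by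
    refine le_trans ?_ (hbad.trans (ENNReal.ofReal_le_ofReal ?_))
    · simp [AM.cyl]
    · simpa [AM.cylProb, AM.wordMap] using hhalf
  have hcover : 1 ≤ Pm x {ω | AM.iter x₀ y₀ ω n x ∈ A} + ENNReal.ofReal (1 / 2) := by
    rw [← huniv]
    refine le_trans ?_ (add_le_add_right hbad' _)
    refine le_trans (measure_mono fun ω _ => ?_) (measure_union_le _ _)
    exact em _
  have hsplit : (1 : ℝ≥0∞) = ENNReal.ofReal (1 / 2) + ENNReal.ofReal (1 / 2) := by
    rw [← ENNReal.ofReal_add (by norm_num) (by norm_num)]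
    norm_num
  rw [hsplit] at hcover
  exact (ENNReal.add_le_add_iff_right ENNReal.ofReal_ne_top).1 hcover
end
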